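/- arXiv:2005.02685 — 6 statements merged into one kernel-verified Lean document; each statement's English description precedes it below -/
import Mathlib

section
/- The infinite series ∑_{n=1}^∞ 1/(n² + n − 1) converges and equals 1 + (√5/5)·π·tan(√5·π/2). -/
open Real

def lucas : ℕ → ℕ
  | 0 => 2
  | 1 => 1
  | n + 2 => lucas n + lucas (n + 1)

def fibZ (n : ℤ) : ℤ :=
  if 0 ≤ n then (Nat.fib n.toNat : ℤ) else (-1) ^ (n.natAbs + 1) * (Nat.fib n.natAbs : ℤ)

def lucasZ (n : ℤ) : ℤ :=
  if 0 ≤ n then (lucas n.toNat : ℤ) else (-1) ^ n.natAbs * (lucas n.natAbs : ℤ)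

theorem goldenRatio_mem_integerComplement : (goldenRatio : ℂ) ∈ Complex.integerComplement := by
  rintro ⟨m, hm⟩
  exact goldenRatio_irrational.ne_int m (by exact_mod_cast hm.symm)

theorem cot_pi_mul_goldenRatio : cot (π * goldenRatio) = -tan (sqrt 5 * π / 2) := by
  rw [show π * goldenRatio = sqrt 5 * π / 2 + π / 2 by unfold goldenRatio; ring,
    cot_eq_cos_div_sin, cos_add_pi_div_two, sin_add_pi_div_two, tan_eq_sin_div_cos, neg_div]

theorem tendsto_sum_cotTerm_goldenRatio :
    Filter.Tendsto (fun N : ℕ => ∑ k ∈ Finset.range N,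
      (1 / (goldenRatio - (k + 1)) + 1 / (goldenRatio + (k + 1)))) Filter.atTop
      (nhds (π * cot (π * goldenRatio) - 1 / goldenRatio)) := by
  have h := tendsto_logDeriv_euler_cot_sub goldenRatio_mem_integerComplement
  simp only [cotTerm] at h
  rw [Complex.isUniformEmbedding_ofReal.isEmbedding.tendsto_nhds_iff]
  simpa [Function.comp_def] using h

theorem one_div_eq_telescope_sub_cotTerm (k : ℕ) :
    1 / ((k + 1 : ℝ) ^ 2 + (k + 1) - 1) =
      (1 / sqrt 5) * ((1 / (goldenRatio - ((k : ℝ) + 1)) -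
          1 / (goldenRatio - (((k + 1 : ℕ) : ℝ) + 1))) -
        (1 / (goldenRatio - (k + 1)) + 1 / (goldenRatio + (k + 1)))) := by
  have h₁ : goldenRatio - (((k + 1 : ℕ) : ℝ) + 1) ≠ 0 :=
    sub_ne_zero.2 (by exact_mod_cast goldenRatio_irrational.ne_nat (k + 1 + 1))
  have h₂ : goldenRatio + ((k : ℝ) + 1) ≠ 0 := by have := goldenRatio_pos; positivity
  have h₃ : (k + 1 : ℝ) ^ 2 + (k + 1) - 1 =
      -((goldenRatio - (((k + 1 : ℕ) : ℝ) + 1)) * (goldenRatio + ((k : ℝ) + 1))) := by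
    push_cast
    linear_combination goldenRatio_sq
  have h₄ : sqrt 5 = 2 * goldenRatio - 1 := by unfold goldenRatio; ring
  have h₅ : 2 * goldenRatio - 1 ≠ 0 := by rw [← h₄]; positivity
  rw [h₃, h₄]
  generalize 1 / (goldenRatio - ((k : ℝ) + 1)) = a
  rw [show a - 1 / (goldenRatio - (((k + 1 : ℕ) : ℝ) + 1)) - (a + 1 / (goldenRatio + (k + 1))) =
    -(1 / (goldenRatio - (((k + 1 : ℕ) : ℝ) + 1)) + 1 / (goldenRatio + ((k : ℝ) + 1))) by ring]
  rw [one_div_add_one_div h₁ h₂]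
  field_simp
  push_cast
  ring

theorem tendsto_one_div_goldenRatio_sub :
    Filter.Tendsto (fun N : ℕ => 1 / (goldenRatio - ((N : ℝ) + 1))) Filter.atTop (nhds 0) := by
  have h : Filter.Tendsto (fun N : ℕ => goldenRatio - ((N : ℝ) + 1)) Filter.atTop Filter.atBot :=
    Filter.tendsto_atBot_add_const_left _ goldenRatio
      (Filter.tendsto_neg_atTop_atBot.comp
        (Filter.tendsto_atTop_add_const_right _ 1 tendsto_natCast_atTop_atTop))
  simpa only [one_div] using! tendsto_inv_atBot_zero.comp h

theorem hasSum_one_div_sq_add_sub_one :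
    HasSum (fun n : ℕ => 1 / ((n + 1 : ℝ) ^ 2 + (n + 1) - 1))
      (1 + sqrt 5 / 5 * π * tan (sqrt 5 * π / 2)) := by
  rw [hasSum_iff_tendsto_nat_of_nonneg fun n =>
    one_div_nonneg.2 (by nlinarith [n.cast_nonneg (α := ℝ)])]
  simp_rw [one_div_eq_telescope_sub_cotTerm, ← Finset.mul_sum,
    Finset.sum_sub_distrib _ (fun k : ℕ => 1 / (goldenRatio - ((k : ℝ) + 1)) + _),
    Finset.sum_range_sub' (fun k : ℕ => 1 / (goldenRatio - ((k : ℝ) + 1)))]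
  convert ((tendsto_one_div_goldenRatio_sub.const_sub _).sub
    tendsto_sum_cotTerm_goldenRatio).const_mul (1 / sqrt 5) using 2
  have h₁ : goldenRatio - 1 ≠ 0 := sub_ne_zero.2 one_lt_goldenRatio.ne'
  have h₂ : 1 / (goldenRatio - 1) = goldenRatio := by
    rw [div_eq_iff h₁]
    linear_combination -goldenRatio_sq
  have h₃ : 1 / goldenRatio = goldenRatio - 1 := by
    rw [div_eq_iff goldenRatio_ne_zero]
    linear_combination -goldenRatio_sq
  have h₄ : 2 * goldenRatio - 1 = sqrt 5 := by unfold goldenRatio; ring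
  have h₅ : 1 / sqrt 5 = sqrt 5 / 5 := by
    rw [div_eq_div_iff (by positivity) (by norm_num)]
    simp
  rw [cot_pi_mul_goldenRatio, Nat.cast_zero, zero_add, h₂, h₃, h₅]
  linear_combination (-sqrt 5 / 5) * h₄ - (1 / 5) * sq_sqrt (show (0 : ℝ) ≤ 5 by norm_num)

theorem stmt0 :
    Summable (fun n : ℕ => 1 / ((n + 1 : ℝ) ^ 2 + (n + 1) - 1)) ∧
    ∑' n : ℕ, 1 / ((n + 1 : ℝ) ^ 2 + (n + 1) - 1) =
      1 + Real.sqrt 5 / 5 * π * Real.tan (Real.sqrt 5 * π / 2) := by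
  exact ⟨hasSum_one_div_sq_add_sub_one.summable, hasSum_one_div_sq_add_sub_one.tsum_eq⟩
end

section
/- For every integer m ≥ 0, ∑_{k=1}^∞ (ζ(2k) − 1)·L_{2k+m−1} = (√5·π/2)·tan(√5·π/2)·F_m + (1/2)·L_{m+2}. -/
open Real

open scoped goldenRatio

theorem lucas_eq_goldenRatio_pow_add (n : ℕ) : (lucas n : ℝ) = φ ^ n + ψ ^ n := by
  induction n using Nat.twoStepInduction with
  | zero => norm_num [lucas]
  | one => simp [lucas, goldenRatio_add_goldenConj]
  | more n h₀ h₁ =>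
    rw [lucas, Nat.cast_add, h₀, h₁]
    linear_combination (-φ ^ n) * goldenRatio_sq - ψ ^ n * goldenConj_sq

theorem hasSum_zeta_sub_one {k : ℕ} (hk : 1 < k) :
    HasSum (fun n : ℕ ↦ 1 / ((n : ℂ) + 2) ^ k) (riemannZeta k - 1) := by
  have hs : Summable fun n : ℕ ↦ 1 / (n : ℂ) ^ k := by
    refine .of_norm ?_
    simpa using Real.summable_one_div_nat_pow.mpr hk
  have h := (hasSum_nat_add_iff' 2).mpr hs.hasSum
  rw [← zeta_nat_eq_tsum_of_gt_one hk] at h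
  simpa [Finset.sum_range_succ, show k ≠ 0 by omega] using h

theorem hasSum_div_sq_sub_sq {x : ℂ} (hx : x ∈ Complex.integerComplement) :
    HasSum (fun n : ℕ ↦ x / (((n : ℂ) + 2) ^ 2 - x ^ 2))
      ((1 / x - π * Complex.cot (π * x)) / 2 - x / (1 - x ^ 2)) := by
  have hs := (summable_cotTerm hx).hasSum
  have hc : ∑' n, cotTerm x n = π * Complex.cot (π * x) - 1 / x := (cot_series_rep' hx).symm
  rw [hc] at hs
  have hterm (n : ℕ) : cotTerm x n = -2 * (x / (((n : ℂ) + 1) ^ 2 - x ^ 2)) := by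
    have h₁ : x + (n + 1) ≠ 0 := by
      simpa using Complex.integerComplement_add_ne_zero hx (n + 1)
    have h₂ : x - (n + 1) ≠ 0 := by
      simpa [sub_eq_add_neg] using Complex.integerComplement_add_ne_zero hx (-(n + 1))
    have h₃ : ((n : ℂ) + 1) ^ 2 - x ^ 2 ≠ 0 := by
      rw [show ((n : ℂ) + 1) ^ 2 - x ^ 2 = -((x + (n + 1)) * (x - (n + 1))) by ring]
      exact neg_ne_zero.mpr (mul_ne_zero h₁ h₂)
    rw [cotTerm]
    field_simp
    ring
  convert ((hasSum_nat_add_iff' 1).mpr hs).mul_left (-1 / 2) using 1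
  · rfl
  · funext n
    rw [hterm]
    push_cast
    ring
  · rw [Finset.sum_range_one, hterm]
    push_cast
    ring

theorem hasSum_zeta_even_sub_one_mul_pow {x : ℂ} (hx : x ∈ Complex.integerComplement)
    (hx2 : ‖x‖ < 2) :
    HasSum (fun k : ℕ ↦ (riemannZeta (2 * (k + 1)) - 1) * x ^ (2 * k + 1))
      ((1 / x - π * Complex.cot (π * x)) / 2 - x / (1 - x ^ 2)) := by
  let f : ℕ × ℕ → ℂ := fun p ↦ x ^ (2 * p.2 + 1) / ((p.1 : ℂ) + 2) ^ (2 * p.2 + 2)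
  have hf : Summable f := by
    have hn : Summable fun n : ℕ ↦ 1 / ((n : ℝ) + 2) ^ 2 := by
      simpa using (summable_nat_add_iff 2).mpr (Real.summable_one_div_nat_pow.mpr one_lt_two)
    have hk : Summable fun k : ℕ ↦ ‖x‖ * ((‖x‖ / 2) ^ 2) ^ k := by
      refine (summable_geometric_of_lt_one (by positivity) ?_).mul_left _
      exact pow_lt_one₀ (by positivity) (by linarith) two_ne_zero
    refine (hn.mul_of_nonneg hk (fun _ ↦ by positivity) (fun _ ↦ by positivity)).of_norm_bounded ?_
    rintro ⟨n, k⟩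
    have hnorm : ‖(n : ℂ) + 2‖ = n + 2 := by
      exact_mod_cast Complex.norm_natCast (n + 2)
    have hle : (‖x‖ / (n + 2)) ^ (2 * k) ≤ (‖x‖ / 2) ^ (2 * k) := by
      gcongr
      linarith [(n.cast_nonneg : (0 : ℝ) ≤ n)]
    calc ‖f (n, k)‖ = 1 / ((n : ℝ) + 2) ^ 2 * (‖x‖ * (‖x‖ / (n + 2)) ^ (2 * k)) := by
          simp only [f, norm_div, norm_pow, hnorm, div_pow]
          field_simp
          ring
      _ ≤ 1 / ((n : ℝ) + 2) ^ 2 * (‖x‖ * ((‖x‖ / 2) ^ 2) ^ k) := by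
          rw [← pow_mul]
          gcongr
  have hrow (n : ℕ) : HasSum (fun k ↦ f (n, k)) (x / (((n : ℂ) + 2) ^ 2 - x ^ 2)) := by
    have hnorm : ‖(n : ℂ) + 2‖ = n + 2 := by
      exact_mod_cast Complex.norm_natCast (n + 2)
    have hn0 : (n : ℂ) + 2 ≠ 0 := by exact_mod_cast (n + 1).succ_ne_zero
    have hlt : ‖(x / ((n : ℂ) + 2)) ^ 2‖ < 1 := by
      rw [norm_pow, norm_div, hnorm]
      refine pow_lt_one₀ (by positivity) ?_ two_ne_zero
      rw [div_lt_one (by positivity)]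
      linarith [(n.cast_nonneg : (0 : ℝ) ≤ n)]
    have h1 : 1 - (x / ((n : ℂ) + 2)) ^ 2 ≠ 0 := by
      intro h
      rw [← sub_eq_zero.mp h] at hlt
      simp at hlt
    convert (hasSum_geometric_of_norm_lt_one hlt).mul_left (x / ((n : ℂ) + 2) ^ 2) using 1
    · rfl
    · funext k
      simp only [f, ← pow_mul, div_pow]
      field_simp
      ring
    · rw [show ((n : ℂ) + 2) ^ 2 - x ^ 2 = (n + 2) ^ 2 * (1 - (x / ((n : ℂ) + 2)) ^ 2) by
        field_simp]
      field_simp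
  have hcol (k : ℕ) : HasSum (fun n ↦ f (n, k))
      ((riemannZeta (2 * (k + 1)) - 1) * x ^ (2 * k + 1)) := by
    convert (hasSum_zeta_sub_one (k := 2 * k + 2) (by omega)).mul_right (x ^ (2 * k + 1)) using 1
    · rfl
    · funext n
      simp only [f]
      ring
    · push_cast
      ring_nf
  have htotal : HasSum f ((1 / x - π * Complex.cot (π * x)) / 2 - x / (1 - x ^ 2)) := by
    rw [(hasSum_div_sq_sub_sq hx).unique (hf.hasSum.prod_fiberwise hrow)]
    exact hf.hasSum
  exact ((Equiv.prodComm ℕ ℕ).hasSum_iff.mpr htotal).prod_fiberwise hcol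

theorem Irrational.ofReal_mem_integerComplement {x : ℝ} (hx : Irrational x) :
    (x : ℂ) ∈ Complex.integerComplement := by
  rintro ⟨n, hn⟩
  exact hx.ne_int n (by exact_mod_cast hn.symm)

theorem Complex.cot_pi_div_two_add (z : ℂ) : cot (π / 2 + z) = -tan z := by
  rw [cot, add_comm, Complex.cos_add_pi_div_two, Complex.sin_add_pi_div_two, tan, neg_div]

theorem hasSum_zeta_even_sub_one_mul_goldenRatio_pow :
    HasSum (fun k : ℕ ↦ (riemannZeta (2 * (k + 1)) - 1) * (φ : ℂ) ^ (2 * k + 1))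
      ((-ψ + π * Real.tan (√5 * π / 2)) / 2 + 1 : ℝ) := by
  convert hasSum_zeta_even_sub_one_mul_pow goldenRatio_irrational.ofReal_mem_integerComplement
    (by
      rw [Complex.norm_real, Real.norm_eq_abs, abs_of_pos goldenRatio_pos]
      exact goldenRatio_lt_two) using 1
  have hcot : Complex.cot (π * (φ : ℂ)) = -Real.tan (√5 * π / 2) := by
    rw [Complex.ofReal_tan, ← Complex.cot_pi_div_two_add, Real.goldenRatio]
    push_cast
    ring_nf
  have hfrac : φ / (1 - φ ^ 2) = -1 := by
    rw [goldenRatio_sq, sub_add_cancel_right, div_neg, div_self goldenRatio_ne_zero]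
  rw [hcot, one_div, ← Complex.ofReal_inv, inv_goldenRatio]
  have hfrac' : (φ : ℂ) / (1 - φ ^ 2) = -1 := by exact_mod_cast hfrac
  rw [hfrac']
  push_cast
  ring

theorem hasSum_zeta_even_sub_one_mul_goldenConj_pow :
    HasSum (fun k : ℕ ↦ (riemannZeta (2 * (k + 1)) - 1) * (ψ : ℂ) ^ (2 * k + 1))
      ((-φ - π * Real.tan (√5 * π / 2)) / 2 + 1 : ℝ) := by
  convert hasSum_zeta_even_sub_one_mul_pow goldenConj_irrational.ofReal_mem_integerComplement
    (by
      rw [Complex.norm_real, Real.norm_eq_abs, abs_of_neg goldenConj_neg]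
      linarith [neg_one_lt_goldenConj]) using 1
  have hcot : Complex.cot (π * (ψ : ℂ)) = Real.tan (√5 * π / 2) := by
    rw [Complex.ofReal_tan, ← neg_neg (Complex.tan _), ← Complex.tan_neg,
      ← Complex.cot_pi_div_two_add, Real.goldenConj]
    push_cast
    ring_nf
  have hfrac : ψ / (1 - ψ ^ 2) = -1 := by
    rw [goldenConj_sq, sub_add_cancel_right, div_neg, div_self goldenConj_ne_zero]
  rw [hcot, one_div, ← Complex.ofReal_inv, inv_goldenConj]
  have hfrac' : (ψ : ℂ) / (1 - ψ ^ 2) = -1 := by exact_mod_cast hfrac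
  rw [hfrac']
  push_cast
  ring

theorem stmt2 (m : ℕ) :
    ∑' k : ℕ, (riemannZeta (2 * (k + 1)) - 1) * (lucas (2 * k + m + 1) : ℂ) =
      ((Real.sqrt 5 * π / 2 * Real.tan (Real.sqrt 5 * π / 2) * (Nat.fib m : ℝ)
        + (lucas (m + 2) : ℝ) / 2 : ℝ) : ℂ) := by
  have h := (hasSum_zeta_even_sub_one_mul_goldenRatio_pow.mul_right ((φ : ℂ) ^ m)).add
    (hasSum_zeta_even_sub_one_mul_goldenConj_pow.mul_right ((ψ : ℂ) ^ m))
  convert h.tsum_eq using 1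
  · refine tsum_congr fun k ↦ ?_
    have hL : (lucas (2 * k + m + 1) : ℂ) =
        (φ : ℂ) ^ (2 * k + m + 1) + (ψ : ℂ) ^ (2 * k + m + 1) := by
      exact_mod_cast congrArg Complex.ofReal (lucas_eq_goldenRatio_pow_add (2 * k + m + 1))
    rw [hL]
    ring
  · have h5 : √5 ^ 2 = 5 := Real.sq_sqrt (by norm_num)
    rw [lucas_eq_goldenRatio_pow_add, coe_fib_eq]
    norm_cast
    field_simp
    linear_combination (φ ^ m + ψ ^ m) / 2 * h5
end

section
/- The series ∑_{k=1}^∞ (ζ(2k+1) − 1)·F_{2k} converges and equals 1/2. -/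
open Real

open goldenRatio in
/-- The generating function of the even-indexed Fibonacci numbers at `1 / m ^ 2`. -/
theorem hasSum_fib_even_div_pow {m : ℝ} (hm : 2 ≤ m) :
    HasSum (fun k : ℕ => (Nat.fib (2 * (k + 1)) : ℝ) / m ^ (2 * (k + 1) + 1))
      (m / ((m ^ 2 - m - 1) * (m ^ 2 + m - 1))) := by
  have hφ := Real.goldenRatio_sq
  have hψ := Real.goldenConj_sq
  have hadd := Real.goldenRatio_add_goldenConj
  have hmul := Real.goldenRatio_mul_goldenConj
  have hsub := Real.goldenRatio_sub_goldenConj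
  have hm0 : 0 < m := by linarith
  have hφ2 : φ < 2 := Real.goldenRatio_lt_two
  have hψ0 : ψ < 0 := Real.goldenConj_neg
  have hφm : φ ^ 2 < m ^ 2 := by nlinarith
  have hψm : ψ ^ 2 < m ^ 2 := by nlinarith
  have hs5 : (0 : ℝ) < √5 := by positivity
  have geom (x : ℝ) (hx : x ^ 2 < m ^ 2) :
      HasSum (fun k : ℕ => x ^ (2 * (k + 1)) / m ^ (2 * (k + 1) + 1))
        (x ^ 2 / m / (m ^ 2 - x ^ 2)) := by
    have hr : x ^ 2 / m ^ 2 < 1 := by rw [div_lt_one (by positivity)]; exact hx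
    have h := (hasSum_geometric_of_lt_one (by positivity) hr).mul_left (x ^ 2 / m ^ 3)
    have hne : m ^ 2 - x ^ 2 ≠ 0 := by linarith
    convert h using 1
    · rfl
    · funext k
      rw [div_pow, ← pow_mul, ← pow_mul, div_mul_div_comm]
      congr 1 <;> ring
    · have : 1 - x ^ 2 / m ^ 2 = (m ^ 2 - x ^ 2) / m ^ 2 := by field_simp
      rw [this]
      field_simp
  have h := ((geom φ hφm).sub (geom ψ hψm)).mul_left (√5)⁻¹
  convert h using 1
  · rfl
  · funext k
    rw [Real.coe_fib_eq]
    field_simp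
  · have h1 : m ^ 2 - φ ^ 2 ≠ 0 := by linarith
    have h2 : m ^ 2 - ψ ^ 2 ≠ 0 := by linarith
    have hprod : (m ^ 2 - φ ^ 2) * (m ^ 2 - ψ ^ 2) = (m ^ 2 - m - 1) * (m ^ 2 + m - 1) := by
      linear_combination (-m ^ 2) * (hφ + hψ + hadd) + (φ * ψ - 1) * hmul
    have hdiff : φ ^ 2 - ψ ^ 2 = √5 := by
      linear_combination hφ - hψ + hsub
    rw [div_div, div_div, div_sub_div _ _ (by positivity) (by positivity), ← hprod]
    field_simp
    linear_combination (-m ^ 2) * hdiff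

open Filter Topology in
/-- With `m = n + 2`, the terms telescope as half of `1 / (m ^ 2 - m - 1) - 1 / (m ^ 2 + m - 1)`. -/
theorem hasSum_telescoping_div :
    HasSum (fun n : ℕ => ((n : ℝ) + 2) /
      ((((n : ℝ) + 2) ^ 2 - ((n : ℝ) + 2) - 1) * (((n : ℝ) + 2) ^ 2 + ((n : ℝ) + 2) - 1)))
      (1 / 2) := by
  have hpos (n : ℕ) : (0 : ℝ) < ((n : ℝ) + 2) ^ 2 - ((n : ℝ) + 2) - 1 := by
    have : (0 : ℝ) ≤ n := n.cast_nonneg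
    nlinarith
  have hpos' (n : ℕ) : (0 : ℝ) < ((n : ℝ) + 2) ^ 2 + ((n : ℝ) + 2) - 1 := by
    have : (0 : ℝ) ≤ n := n.cast_nonneg
    nlinarith
  rw [hasSum_iff_tendsto_nat_of_nonneg fun n =>
    div_nonneg (by positivity) (mul_pos (hpos n) (hpos' n)).le]
  have hsum (N : ℕ) : ∑ n ∈ Finset.range N, ((n : ℝ) + 2) /
      ((((n : ℝ) + 2) ^ 2 - ((n : ℝ) + 2) - 1) * (((n : ℝ) + 2) ^ 2 + ((n : ℝ) + 2) - 1)) =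
      1 / 2 - 1 / 2 * (((N : ℝ) + 2) ^ 2 - ((N : ℝ) + 2) - 1)⁻¹ := by
    induction N with
    | zero => norm_num
    | succ N ih =>
      rw [Finset.sum_range_succ, ih]
      have h1 := (hpos N).ne'
      have h2 := (hpos' N).ne'
      have h3 : (((N + 1 : ℕ) : ℝ) + 2) ^ 2 - (((N + 1 : ℕ) : ℝ) + 2) - 1 =
        ((N : ℝ) + 2) ^ 2 + ((N : ℝ) + 2) - 1 := by push_cast; ring
      rw [h3]
      generalize (N : ℝ) + 2 = m at *
      have h4 : m / ((m ^ 2 - m - 1) * (m ^ 2 + m - 1)) =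
          1 / 2 * ((m ^ 2 - m - 1)⁻¹ - (m ^ 2 + m - 1)⁻¹) := by
        rw [inv_sub_inv h1 h2, mul_div_assoc']
        congr 1
        ring
      rw [h4]
      ring
  simp_rw [hsum]
  have hlim : Tendsto (fun N : ℕ => ((N : ℝ) + 2) ^ 2 - ((N : ℝ) + 2) - 1) atTop atTop := by
    refine tendsto_atTop_mono (fun N => ?_) tendsto_natCast_atTop_atTop
    have : (0 : ℝ) ≤ N := N.cast_nonneg
    nlinarith
  simpa using (hlim.inv_tendsto_atTop.const_mul (1 / 2 : ℝ)).const_sub (1 / 2 : ℝ)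

theorem hasSum_riemannZeta_sub_one {s : ℕ} (hs : 1 < s) :
    HasSum (fun n : ℕ => 1 / ((n : ℂ) + 2) ^ s) (riemannZeta s - 1) := by
  have hsum : Summable fun n : ℕ => 1 / (n : ℂ) ^ s := by
    rw [← summable_norm_iff]
    simpa using Real.summable_one_div_nat_pow.mpr hs
  have h := (hasSum_nat_add_iff' 2).mpr hsum.hasSum
  rw [← zeta_nat_eq_tsum_of_gt_one hs] at h
  simpa [Finset.sum_range_succ, show s ≠ 0 by omega] using h

theorem hasSum_riemannZeta_odd_sub_one_mul_fib_even :
    HasSum (fun k : ℕ => (riemannZeta (2 * (k + 1) + 1) - 1) * (Nat.fib (2 * (k + 1)) : ℂ))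
      (1 / 2) := by
  let f : ℕ × ℕ → ℝ := fun p =>
    (Nat.fib (2 * (p.2 + 1)) : ℝ) / ((p.1 : ℝ) + 2) ^ (2 * (p.2 + 1) + 1)
  have hrow (n : ℕ) := hasSum_fib_even_div_pow (m := (n : ℝ) + 2)
    (by have : (0 : ℝ) ≤ n := n.cast_nonneg
        linarith)
  have hf : Summable f := by
    rw [summable_prod_of_nonneg fun p => by positivity]
    refine ⟨fun n => (hrow n).summable, ?_⟩
    convert hasSum_telescoping_div.summable using 2 with n
    exact (hrow n).tsum_eq
  have htotal : HasSum f (1 / 2) := by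
    have h := hf.hasSum
    rwa [(h.prod_fiberwise hrow).unique hasSum_telescoping_div] at h
  have hswap : HasSum (fun p : ℕ × ℕ => ((f p.swap : ℝ) : ℂ)) (1 / 2) := by
    have h := Complex.hasSum_ofReal.mpr ((Equiv.prodComm ℕ ℕ).hasSum_iff.mpr htotal)
    simpa using h
  refine hswap.prod_fiberwise fun k => ?_
  have h := (hasSum_riemannZeta_sub_one (s := 2 * (k + 1) + 1) (by omega)).mul_right
    (Nat.fib (2 * (k + 1)) : ℂ)
  convert h using 1
  · rfl
  · funext n
    simp only [f, Prod.swap]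
    push_cast
    ring
  · push_cast
    rfl

theorem stmt9 :
    Summable (fun k : ℕ => (riemannZeta (2 * (k + 1) + 1) - 1) * (Nat.fib (2 * (k + 1)) : ℂ)) ∧
    ∑' k : ℕ, (riemannZeta (2 * (k + 1) + 1) - 1) * (Nat.fib (2 * (k + 1)) : ℂ) = (1 / 2 : ℂ) := by
  exact ⟨hasSum_riemannZeta_odd_sub_one_mul_fib_even.summable,
    hasSum_riemannZeta_odd_sub_one_mul_fib_even.tsum_eq⟩
end

section
/- For every integer m ≥ 0, ∑_{k=2}^∞ (ζ(k) − 1)·F_{k+m−1} = F_{m+1} + F_{m−1}·(π/√5)·tan(√5·π/2) + F_m·∑_{n=1}^∞ 1/(n(n² + n − 1)), where for m = 0 one sets F_{−1} = 1 (the standard extension F_{−n} = (−1)^{n+1}F_n). -/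
open Real

theorem hasSum_fib_mul_pow (m : ℕ) {x : ℝ} (hx0 : 0 ≤ x) (hx : x ≤ 1 / 2) :
    HasSum (fun k : ℕ => (Nat.fib (k + m + 1) : ℝ) * x ^ k)
      (((Nat.fib (m + 1) : ℝ) + Nat.fib m * x) / (1 - x - x ^ 2)) := by
  have h5 : (√5 : ℝ) ≠ 0 := by positivity
  have hg0 := goldenRatio_pos
  have hg2 := goldenRatio_lt_two
  have hc0 := goldenConj_neg
  have hc1 := neg_one_lt_goldenConj
  have hmul := goldenRatio_mul_goldenConj
  have hadd := goldenRatio_add_goldenConj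
  have hgx : goldenRatio * x < 1 := by nlinarith
  have hcx : |goldenConj * x| < 1 := by
    rw [abs_lt]
    constructor <;> nlinarith
  have hgx' : |goldenRatio * x| < 1 := by
    rw [abs_of_nonneg (by positivity)]
    exact hgx
  have h1 := (hasSum_geometric_of_abs_lt_one hgx').mul_left (goldenRatio ^ (m + 1) / √5)
  have h2 := (hasSum_geometric_of_abs_lt_one hcx).mul_left (goldenConj ^ (m + 1) / √5)
  have h := h1.sub h2
  have hd1 : 1 - goldenRatio * x ≠ 0 := by linarith
  have hd2 : 1 - goldenConj * x ≠ 0 := by nlinarith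
  have hd : 1 - x - x ^ 2 = (1 - goldenRatio * x) * (1 - goldenConj * x) := by
    linear_combination (-x ^ 2) * hmul + x * hadd
  have hF (j : ℕ) := coe_fib_eq j
  generalize goldenRatio = a at *
  generalize goldenConj = b at *
  convert h using 1 <;> try rfl
  · funext k
    rw [hF, mul_pow, mul_pow]
    field_simp
    ring
  · rw [hF, hF, hd, ← div_eq_mul_inv, ← div_eq_mul_inv, div_sub_div _ _ hd1 hd2]
    congr 1
    field_simp
    linear_combination (x * (a ^ m - b ^ m)) * hmul

theorem hasSum_one_div_sub_one_div_succ {c : ℝ} (hc : 0 < c) :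
    HasSum (fun n : ℕ => 1 / (n + c) - 1 / (n + 1 + c)) (1 / c) := by
  rw [hasSum_iff_tendsto_nat_of_nonneg]
  · have h (n : ℕ) : ∑ i ∈ Finset.range n, (1 / ((i : ℝ) + c) - 1 / (i + 1 + c)) =
        1 / c - 1 / (n + c) := by
      have := Finset.sum_range_sub' (fun i : ℕ => 1 / ((i : ℝ) + c)) n
      simpa using this
    simp_rw [h]
    have ht : Filter.Tendsto (fun n : ℕ => 1 / ((n : ℝ) + c)) Filter.atTop (nhds 0) := by
      simp_rw [one_div]
      exact (Filter.tendsto_atTop_add_const_right _ c tendsto_natCast_atTop_atTop).inv_tendsto_atTop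
    simpa using ht.const_sub (1 / c)
  · intro n
    rw [sub_nonneg]
    apply one_div_le_one_div_of_le <;> [positivity; linarith]

theorem sqrt_five_sub_one_div_two_mem_integerComplement :
    (((√5 - 1) / 2 : ℝ) : ℂ) ∈ Complex.integerComplement := by
  rintro ⟨n, hn⟩
  have h : (n : ℝ) = (√5 - 1) / 2 := by exact_mod_cast hn
  have h5 : √5 ^ 2 = 5 := Real.sq_sqrt (by norm_num)
  have h0 : (0 : ℝ) < n := by rw [h]; nlinarith [Real.sqrt_nonneg 5]
  have h1 : (n : ℝ) < 1 := by rw [h]; nlinarith [Real.sqrt_nonneg 5]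
  have h0' : 0 < n := by exact_mod_cast h0
  have h1' : n < 1 := by exact_mod_cast h1
  omega

theorem hasSum_one_div_sq_add_self_sub_one :
    HasSum (fun n : ℕ => 1 / ((n + 1 : ℝ) ^ 2 + (n + 1 : ℝ) - 1))
      (1 + π / √5 * Real.tan (√5 * π / 2)) := by
  have hy := sqrt_five_sub_one_div_two_mem_integerComplement
  have h5 : √5 ^ 2 = 5 := Real.sq_sqrt (by norm_num)
  have h50 : (√5 : ℝ) ≠ 0 := by positivity
  set y : ℝ := (√5 - 1) / 2 with hy_def
  have hyy : y ^ 2 + y = 1 := by rw [hy_def]; linear_combination h5 / 4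
  have hy0 : 0 < y := by rw [hy_def]; nlinarith [Real.sqrt_nonneg 5]
  have hy1 : y < 1 := by nlinarith
  have hcot : HasSum (fun n : ℕ => 1 / (y - (n + 1)) + 1 / (y + (n + 1)))
      (π * Real.cot (π * y) - 1 / y) := by
    have h := (summable_cotTerm hy).hasSum
    unfold cotTerm at h
    rw [← cot_series_rep' hy] at h
    exact_mod_cast h
  have htan : Real.cot (π * y) = -Real.tan (√5 * π / 2) := by
    rw [Real.cot_eq_cos_div_sin, Real.tan_eq_sin_div_cos,
      show π * y = √5 * π / 2 - π / 2 by rw [hy_def]; ring, Real.cos_sub_pi_div_two,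
      Real.sin_sub_pi_div_two, div_neg]
  have h6 : √5 = 2 * y + 1 := by rw [hy_def]; ring
  clear_value y
  have h := ((hasSum_one_div_sub_one_div_succ (c := 1 + y) (by positivity)).sub hcot).div_const √5
  convert h using 1 <;> try rfl
  · funext n
    have hn : (0 : ℝ) ≤ n := n.cast_nonneg
    have h1 : y - (n + 1) ≠ 0 := by linarith
    have h2 : y + (n + 1) ≠ 0 := by positivity
    have h3 : (n : ℝ) + 1 + (1 + y) ≠ 0 := by positivity
    have h4 : (n : ℝ) + (1 + y) = y + (n + 1) := by ring
    have hD : ((n : ℝ) + 1) ^ 2 + (n + 1) - 1 = -((y - (n + 1)) * (n + 1 + (1 + y))) := by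
      linear_combination hyy
    rw [hD, h4, eq_div_iff h50, h6]
    field_simp
    ring
  · rw [htan]
    have h7 : 1 / (1 + y) + 1 / y = √5 := by
      have h8 : 1 + y ≠ 0 := by positivity
      rw [h6]
      field_simp
      linear_combination (-(2 * y + 1)) * hyy
    rw [eq_div_iff h50, add_mul, mul_right_comm, div_mul_cancel₀ _ h50]
    linear_combination -h7

theorem hasSum_fib_generating_one_div (m : ℕ) :
    HasSum (fun n : ℕ => ((Nat.fib (m + 1) : ℝ) + Nat.fib m * (1 / (n + 2))) /
        (1 - 1 / (n + 2) - (1 / (n + 2 : ℝ)) ^ 2) * (1 / (n + 2)) ^ 2)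
      ((Nat.fib (m + 1) : ℝ)
        + ((Nat.fib (m + 1) : ℝ) - Nat.fib m) * (π / √5) * Real.tan (√5 * π / 2)
        + (Nat.fib m : ℝ) *
          ∑' n : ℕ, 1 / ((n + 1 : ℝ) * ((n + 1 : ℝ) ^ 2 + (n + 1 : ℝ) - 1))) := by
  have hS := hasSum_one_div_sq_add_self_sub_one
  have hD (n : ℕ) : 0 < (n + 1 : ℝ) ^ 2 + (n + 1 : ℝ) - 1 := by
    have : (0 : ℝ) ≤ n := n.cast_nonneg
    nlinarith
  have hR : Summable fun n : ℕ => 1 / ((n + 1 : ℝ) * ((n + 1 : ℝ) ^ 2 + (n + 1 : ℝ) - 1)) := by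
    refine hS.summable.of_nonneg_of_le (fun n => ?_) (fun n => ?_)
    · have := hD n
      positivity
    · apply one_div_le_one_div_of_le (hD n)
      have : (0 : ℝ) ≤ n := n.cast_nonneg
      nlinarith [hD n]
  have h := (hS.mul_left ((Nat.fib (m + 1) : ℝ) - Nat.fib m)).add
    ((hR.hasSum.add (hasSum_one_div_sub_one_div_succ one_pos)).mul_left (Nat.fib m : ℝ))
  convert h using 1 <;> try rfl
  · funext n
    have h1 := (hD n).ne'
    have h2 : (n : ℝ) + 1 ≠ 0 := by positivity
    have h3 : (n : ℝ) + 2 ≠ 0 := by positivity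
    have h4 : 1 - 1 / (n + 2) - (1 / (n + 2 : ℝ)) ^ 2 =
        ((n + 1 : ℝ) ^ 2 + (n + 1 : ℝ) - 1) / (n + 2) ^ 2 := by
      field_simp
      ring
    rw [h4, show (n : ℝ) + 1 + 1 = n + 2 by ring]
    set D := (n + 1 : ℝ) ^ 2 + (n + 1 : ℝ) - 1 with hD_def
    field_simp
    rw [hD_def]
    ring
  · ring

theorem riemannZeta_add_two_sub_one (k : ℕ) :
    riemannZeta (k + 2) - 1 = ((∑' n : ℕ, (1 / (n + 2 : ℝ)) ^ (k + 2) : ℝ) : ℂ) := by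
  have hs : Summable fun n : ℕ => 1 / (n : ℂ) ^ (k + 2) := by
    have h := Complex.hasSum_ofReal.mpr
      (Real.summable_one_div_nat_pow.mpr (by omega : 1 < k + 2)).hasSum
    simpa using h.summable
  have h := zeta_nat_eq_tsum_of_gt_one (k := k + 2) (by omega)
  rw [← hs.sum_add_tsum_nat_add 2] at h
  push_cast at h ⊢
  rw [h]
  simp [Finset.sum_range_succ]

theorem fibZ_natCast_sub_one (m : ℕ) :
    fibZ ((m : ℤ) - 1) = (Nat.fib (m + 1) : ℤ) - Nat.fib m := by
  cases m with
  | zero => simp [fibZ]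
  | succ m => simp [fibZ, Nat.fib_add_two]

theorem stmt11 (m : ℕ) :
    ∑' k : ℕ, (riemannZeta (k + 2) - 1) * (Nat.fib (k + m + 1) : ℂ) =
      (((Nat.fib (m + 1) : ℝ)
        + (fibZ ((m : ℤ) - 1) : ℝ) * (π / Real.sqrt 5) * Real.tan (Real.sqrt 5 * π / 2)
        + (Nat.fib m : ℝ) *
          ∑' n : ℕ, 1 / ((n + 1 : ℝ) * ((n + 1 : ℝ) ^ 2 + (n + 1 : ℝ) - 1)) : ℝ) : ℂ) := by
  have hg (n : ℕ) := (hasSum_fib_mul_pow m (x := 1 / (n + 2 : ℝ)) (by positivity)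
    (one_div_le_one_div_of_le two_pos (by simp))).mul_right ((1 / (n + 2 : ℝ)) ^ 2)
  have hG := hasSum_fib_generating_one_div m
  have hsum : Summable (Function.uncurry fun n k : ℕ =>
      (Nat.fib (k + m + 1) : ℝ) * (1 / (n + 2 : ℝ)) ^ k * (1 / (n + 2 : ℝ)) ^ 2) := by
    rw [summable_prod_of_nonneg (fun p => by simp only [Function.uncurry, Pi.zero_apply]; positivity)]
    refine ⟨fun n => (hg n).summable, hG.summable.congr fun n => (hg n).tsum_eq.symm⟩
  have hcomm := hsum.tsum_comm
  simp_rw [fun n => (hg n).tsum_eq] at hcomm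
  rw [hG.tsum_eq] at hcomm
  rw [fibZ_natCast_sub_one]
  rw [Int.cast_sub, Int.cast_natCast, Int.cast_natCast]
  rw [← hcomm, Complex.ofReal_tsum]
  congr 1 with k
  rw [riemannZeta_add_two_sub_one, ← Complex.ofReal_natCast, ← Complex.ofReal_mul, ← tsum_mul_right]
  congr 2 with n
  ring
end

section
/- For every integer m ≥ 0, ∑_{k=1}^∞ (ζ(2k) − 1)·F_{2k+m−1}/k = F_{m−1}·ln(−π·sec(√5·π/2)) + (2/√5)·L_{m−1}·ln α, where α = (1+√5)/2, and where for m = 0 one sets F_{−1} = 1 and L_{−1} = −1 (the standard extensions to negative indices). -/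
open Real

/-- The logarithm of the sine product of Euler without its first factor. -/
theorem hasSum_neg_log_one_sub_div_sq {x : ℝ} (hx : x ^ 2 < 4) (hx1 : x ^ 2 ≠ 1)
    (hs : sin (π * x) ≠ 0) :
    HasSum (fun n : ℕ => -log (1 - x ^ 2 / ((n : ℝ) + 2) ^ 2))
      (log (π * x * (1 - x ^ 2) / sin (π * x))) := by
  have hx0 : x ≠ 0 := by rintro rfl; simp at hs
  have hlt (n : ℕ) : x ^ 2 / ((n : ℝ) + 2) ^ 2 < 1 := by
    rw [div_lt_one (by positivity)]
    nlinarith [(Nat.cast_nonneg n : (0 : ℝ) ≤ n)]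
  have h0 (n : ℕ) : 0 ≤ x ^ 2 / ((n : ℝ) + 2) ^ 2 := by positivity
  rw [hasSum_iff_tendsto_nat_of_nonneg]
  swap
  · intro n
    have := log_nonpos (x := 1 - x ^ 2 / ((n : ℝ) + 2) ^ 2) (by linarith [hlt n])
      (by linarith [h0 n])
    linarith
  have hc : π * x * (1 - x ^ 2) ≠ 0 :=
    mul_ne_zero (mul_ne_zero pi_ne_zero hx0) (sub_ne_zero.2 hx1.symm)
  have hprod : Filter.Tendsto
      (fun N : ℕ => ∏ n ∈ Finset.range N, (1 - x ^ 2 / ((n : ℝ) + 2) ^ 2)) Filter.atTop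
      (nhds (sin (π * x) / (π * x * (1 - x ^ 2)))) := by
    have h := ((Filter.tendsto_add_atTop_iff_nat 1).2 (tendsto_euler_sin_prod x)).div_const
      (π * x * (1 - x ^ 2))
    refine h.congr fun N => ?_
    rw [Finset.prod_range_succ', div_eq_iff hc]
    have (n : ℕ) : (((n + 1 : ℕ) : ℝ) + 1) = n + 2 := by push_cast; ring
    simp only [this]
    simp
    ring
  have hlog := (hprod.log (div_ne_zero hs hc)).neg
  rw [← log_inv, inv_div] at hlog
  refine hlog.congr fun N => ?_
  rw [log_prod fun n _ => by linarith [hlt n], Finset.sum_neg_distrib]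

theorem riemannZeta_sub_one_eq_tsum (k : ℕ) :
    riemannZeta (2 * (k + 1)) - 1 =
      ((∑' n : ℕ, 1 / ((n : ℝ) + 2) ^ (2 * (k + 1)) : ℝ) : ℂ) := by
  have hk : 1 < 2 * (k + 1) := by lia
  have hsum : Summable fun n : ℕ => 1 / (n : ℂ) ^ (2 * (k + 1)) := by
    have := Complex.hasSum_ofReal.2 (summable_one_div_nat_pow.2 hk).hasSum
    simpa using this.summable
  have hz := zeta_nat_eq_tsum_of_gt_one hk
  rw [← hsum.sum_add_tsum_nat_add 2] at hz
  push_cast at hz ⊢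
  rw [hz]
  simp [Finset.sum_range_succ]

/-- The even zeta series evaluated through Euler's sine product. -/
theorem hasSum_zeta_sub_one_mul_pow {x : ℝ} (hx : x ^ 2 < 4) (hx1 : x ^ 2 ≠ 1)
    (hs : sin (π * x) ≠ 0) :
    HasSum (fun k : ℕ => (∑' n : ℕ, 1 / ((n : ℝ) + 2) ^ (2 * (k + 1))) *
        x ^ (2 * (k + 1)) / (k + 1))
      (log (π * x * (1 - x ^ 2) / sin (π * x))) := by
  have hlt (n : ℕ) : x ^ 2 / ((n : ℝ) + 2) ^ 2 < 1 := by
    rw [div_lt_one (by positivity)]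
    nlinarith [(Nat.cast_nonneg n : (0 : ℝ) ≤ n)]
  have h0 (n : ℕ) : 0 ≤ x ^ 2 / ((n : ℝ) + 2) ^ 2 := by positivity
  have hout := hasSum_neg_log_one_sub_div_sq hx hx1 hs
  have hin (n : ℕ) := hasSum_pow_div_log_of_abs_lt_one
    (x := x ^ 2 / ((n : ℝ) + 2) ^ 2) (by rw [abs_of_nonneg (h0 n)]; exact hlt n)
  have hsum : Summable fun p : ℕ × ℕ =>
      (x ^ 2 / ((p.1 : ℝ) + 2) ^ 2) ^ (p.2 + 1) / ((p.2 : ℝ) + 1) := by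
    rw [summable_prod_of_nonneg (fun p => by positivity)]
    exact ⟨fun n => (hin n).summable, by simpa only [(hin _).tsum_eq] using hout.summable⟩
  have htot := hsum.hasSum
  rw [(htot.prod_fiberwise hin).unique hout] at htot
  have hswap := (Equiv.prodComm ℕ ℕ).hasSum_iff.2 htot
  have hfib (k : ℕ) := (hswap.summable.prod_factor k).hasSum
  convert hswap.prod_fiberwise hfib using 2 with k
  rw [mul_div_assoc, ← tsum_mul_right]
  refine tsum_congr fun n => ?_
  simp only [Function.comp_apply, Equiv.prodComm_apply, Prod.swap_prod_mk]
  rw [div_pow, ← pow_mul, ← pow_mul]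
  ring

theorem coe_lucas_eq (n : ℕ) : (lucas n : ℝ) = goldenRatio ^ n + goldenConj ^ n := by
  induction n using Nat.twoStepInduction with
  | zero => norm_num [lucas]
  | one => simp [lucas]
  | more n h₁ h₂ =>
    rw [lucas, Nat.cast_add, h₁, h₂, pow_add _ n 2, pow_add _ n 2, goldenRatio_sq, goldenConj_sq]
    ring

theorem coe_fibZ_sub_one (m : ℕ) : (fibZ ((m : ℤ) - 1) : ℝ) =
    (-goldenConj * goldenRatio ^ m + goldenRatio * goldenConj ^ m) / √5 := by
  cases m with
  | zero =>
    have := goldenRatio_sub_goldenConj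
    simp only [pow_zero, mul_one]
    rw [neg_add_eq_sub, this]
    simp [fibZ]
  | succ m =>
    have : fibZ (((m + 1 : ℕ) : ℤ) - 1) = Nat.fib m := by simp [fibZ]
    rw [this, Int.cast_natCast, coe_fib_eq]
    congr 1
    linear_combination (goldenRatio ^ m - goldenConj ^ m) * goldenRatio_mul_goldenConj

theorem coe_lucasZ_sub_one (m : ℕ) : (lucasZ ((m : ℤ) - 1) : ℝ) =
    -goldenConj * goldenRatio ^ m - goldenRatio * goldenConj ^ m := by
  cases m with
  | zero =>
    have := goldenRatio_add_goldenConj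
    simp [lucasZ, lucas]
    linarith
  | succ m =>
    have : lucasZ (((m + 1 : ℕ) : ℤ) - 1) = lucas m := by simp [lucasZ]
    rw [this, Int.cast_natCast, coe_lucas_eq]
    linear_combination (goldenRatio ^ m + goldenConj ^ m) * goldenRatio_mul_goldenConj

theorem cos_sqrt_five_mul_pi_div_two_neg : cos (√5 * π / 2) < 0 := by
  have h1 : 1 < √5 := by rw [lt_sqrt] <;> norm_num
  have h3 : √5 < 3 := by rw [sqrt_lt'] <;> norm_num
  apply cos_neg_of_pi_div_two_lt_of_lt <;> nlinarith [pi_pos]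

theorem sin_pi_mul_goldenRatio : sin (π * goldenRatio) = cos (√5 * π / 2) := by
  rw [← sin_add_pi_div_two]
  congr 1
  rw [goldenRatio]
  ring

theorem sin_pi_mul_goldenConj : sin (π * goldenConj) = cos (√5 * π / 2) := by
  rw [← sin_pi_div_two_sub]
  congr 1
  rw [goldenConj]
  ring

theorem stmt13 (m : ℕ) :
    ∑' k : ℕ, (riemannZeta (2 * (k + 1)) - 1) * (Nat.fib (2 * k + m + 1) : ℂ) / (k + 1 : ℂ) =
      (((fibZ ((m : ℤ) - 1) : ℝ) * Real.log (-π / Real.cos (Real.sqrt 5 * π / 2))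
        + 2 / Real.sqrt 5 * (lucasZ ((m : ℤ) - 1) : ℝ) *
          Real.log ((1 + Real.sqrt 5) / 2) : ℝ) : ℂ) := by
  have hcos := cos_sqrt_five_mul_pi_div_two_neg
  have hA : -π / cos (√5 * π / 2) ≠ 0 := div_ne_zero (neg_ne_zero.2 pi_ne_zero) hcos.ne
  have hφψ := goldenRatio_mul_goldenConj
  have hφ := hasSum_zeta_sub_one_mul_pow (x := goldenRatio)
    (by rw [goldenRatio_sq]; linarith [goldenRatio_lt_two])
    (by rw [goldenRatio_sq]; linarith [goldenRatio_pos])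
    (by rw [sin_pi_mul_goldenRatio]; exact hcos.ne)
  have hψ := hasSum_zeta_sub_one_mul_pow (x := goldenConj)
    (by rw [goldenConj_sq]; linarith [goldenConj_neg])
    (by rw [goldenConj_sq]; linarith [goldenConj_neg])
    (by rw [sin_pi_mul_goldenConj]; exact hcos.ne)
  have hLφ : log (π * goldenRatio * (1 - goldenRatio ^ 2) / sin (π * goldenRatio)) =
      log (-π / cos (√5 * π / 2)) + 2 * log goldenRatio := by
    have hfactor : π * goldenRatio * (1 - goldenRatio ^ 2) / cos (√5 * π / 2) =
        -π / cos (√5 * π / 2) * goldenRatio ^ 2 := by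
      linear_combination (-π / cos (√5 * π / 2)) * goldenRatio * goldenRatio_sq
    rw [sin_pi_mul_goldenRatio, hfactor, log_mul hA (pow_ne_zero 2 goldenRatio_ne_zero), log_pow]
    norm_num
  have hLψ : log (π * goldenConj * (1 - goldenConj ^ 2) / sin (π * goldenConj)) =
      log (-π / cos (√5 * π / 2)) - 2 * log goldenRatio := by
    have hlog : log goldenConj = -log goldenRatio := by
      rw [← log_inv, inv_goldenRatio, log_neg_eq_log]
    have hfactor : π * goldenConj * (1 - goldenConj ^ 2) / cos (√5 * π / 2) =
        -π / cos (√5 * π / 2) * goldenConj ^ 2 := by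
      linear_combination (-π / cos (√5 * π / 2)) * goldenConj * goldenConj_sq
    rw [sin_pi_mul_goldenConj, hfactor, log_mul hA (pow_ne_zero 2 goldenConj_ne_zero), log_pow, hlog]
    push_cast
    ring
  rw [hLφ] at hφ
  rw [hLψ] at hψ
  have h := ((hφ.mul_left (-goldenConj * goldenRatio ^ m)).add
    (hψ.mul_left (goldenRatio * goldenConj ^ m))).div_const √5
  have hC := (Complex.hasSum_ofReal.2 h).tsum_eq
  convert hC using 1
  · refine tsum_congr fun k => ?_
    rw [riemannZeta_sub_one_eq_tsum]
    have hf : (Nat.fib (2 * k + m + 1) : ℝ) =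
        (-goldenConj * goldenRatio ^ m * goldenRatio ^ (2 * (k + 1)) +
          goldenRatio * goldenConj ^ m * goldenConj ^ (2 * (k + 1))) / √5 := by
      rw [coe_fib_eq]
      congr 1
      linear_combination (goldenRatio ^ (2 * k + m + 1) - goldenConj ^ (2 * k + m + 1)) * hφψ
    rw [← Complex.ofReal_natCast, hf]
    push_cast
    ring
  · rw [coe_fibZ_sub_one, coe_lucasZ_sub_one, ← goldenRatio]
    congr 1
    ring
end

section
/- The series ∑_{k=1}^∞ (ζ(2k) − 1)·F_{2k}/k converges and equals (4/√5)·ln α, where α = (1+√5)/2. -/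
open Real

open Filter Topology goldenRatio

theorem riemannZeta_two_mul_add_one_eq_ofReal (k : ℕ) :
    riemannZeta (2 * (k + 1)) = ((∑' n : ℕ, 1 / (n : ℝ) ^ (2 * (k + 1)) : ℝ) : ℂ) := by
  have h := zeta_nat_eq_tsum_of_gt_one (k := 2 * (k + 1)) (by omega)
  push_cast at h ⊢
  exact h

theorem hasSum_one_div_nat_add_two_pow (k : ℕ) :
    HasSum (fun n : ℕ => 1 / ((n : ℝ) + 2) ^ (2 * (k + 1)))
      ((riemannZeta (2 * (k + 1))).re - 1) := by
  have hs : Summable (fun n : ℕ => 1 / (n : ℝ) ^ (2 * (k + 1))) :=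
    Real.summable_one_div_nat_pow.2 (by omega)
  rw [riemannZeta_two_mul_add_one_eq_ofReal, Complex.ofReal_re]
  simpa [Finset.sum_range_succ] using (hasSum_nat_add_iff' 2).2 hs.hasSum

/-- The potential whose differences are the inner sums in `hasSum_fib_div_pow`. -/
noncomputable def logRatio (n : ℕ) : ℝ :=
  Real.log (n + 1 + φ) - Real.log (n + 2 - φ)

theorem hasSum_fib_div_pow (n : ℕ) :
    HasSum (fun k : ℕ => (Nat.fib (2 * (k + 1)) : ℝ) / (k + 1) *
        (1 / ((n : ℝ) + 2) ^ (2 * (k + 1))))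
      ((logRatio n - logRatio (n + 1)) / √5) := by
  have hn : (0 : ℝ) ≤ n := n.cast_nonneg
  have hφ := Real.goldenRatio_lt_two
  have hφ1 := Real.one_lt_goldenRatio
  have hψ : ψ = 1 - φ := by linarith [Real.goldenRatio_add_goldenConj]
  have key : ∀ x : ℝ, -2 < x → x < 2 →
      HasSum (fun k : ℕ => (x ^ 2 / ((n : ℝ) + 2) ^ 2) ^ (k + 1) / (k + 1))
        (2 * Real.log (n + 2) - Real.log (n + 2 - x) - Real.log (n + 2 + x)) := by
    intro x h1 h2
    have hlt : x ^ 2 / ((n : ℝ) + 2) ^ 2 < 1 := by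
      rw [div_lt_one (by positivity)]
      nlinarith
    have h := Real.hasSum_pow_div_log_of_abs_lt_one
      (x := x ^ 2 / ((n : ℝ) + 2) ^ 2) (by rwa [abs_of_nonneg (by positivity)])
    convert h using 1
    have hx : 1 - x ^ 2 / ((n : ℝ) + 2) ^ 2 =
        (n + 2 - x) * (n + 2 + x) / ((n : ℝ) + 2) ^ 2 := by
      field_simp
      ring
    have a1 : (n : ℝ) + 2 - x ≠ 0 := by linarith
    have a2 : (n : ℝ) + 2 + x ≠ 0 := by linarith
    rw [hx, Real.log_div (mul_ne_zero a1 a2) (by positivity), Real.log_mul a1 a2, Real.log_pow]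
    push_cast
    ring
  have h := ((key φ (by linarith) hφ).sub (key ψ (by linarith) (by linarith))).div_const √5
  have hval : (logRatio n - logRatio (n + 1)) / √5 =
      (2 * Real.log (n + 2) - Real.log (n + 2 - φ) - Real.log (n + 2 + φ) -
        (2 * Real.log (n + 2) - Real.log (n + 2 - ψ) - Real.log (n + 2 + ψ))) / √5 := by
    rw [logRatio, logRatio, hψ]
    push_cast
    rw [show (n : ℝ) + 2 - (1 - φ) = n + 1 + φ by ring,
      show (n : ℝ) + 2 + (1 - φ) = n + 1 + 2 - φ by ring,
      show (n : ℝ) + 1 + 1 + φ = n + 2 + φ by ring]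
    ring
  rw [hval]
  refine h.congr_fun fun k => ?_
  rw [Real.coe_fib_eq, div_pow (φ ^ 2), div_pow (ψ ^ 2), ← pow_mul, ← pow_mul, ← pow_mul]
  ring

theorem logRatio_zero : logRatio 0 = 4 * Real.log φ := by
  have hφ := Real.goldenRatio_lt_two
  have hφ1 := Real.one_lt_goldenRatio
  have hsq := Real.goldenRatio_sq
  have h : (1 + φ) = φ ^ 4 * (2 - φ) := by
    have h4 : φ ^ 4 = 3 * φ + 2 := by
      rw [show φ ^ 4 = (φ ^ 2) ^ 2 by ring, hsq]
      linear_combination hsq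
    rw [h4]
    linear_combination 3 * hsq
  rw [logRatio, Nat.cast_zero, zero_add, zero_add, h,
    Real.log_mul (by positivity) (by linarith), Real.log_pow]
  push_cast
  ring

theorem tendsto_logRatio : Tendsto logRatio atTop (𝓝 0) := by
  have hφ := Real.goldenRatio_lt_two
  have hφ1 := Real.one_lt_goldenRatio
  have hden : Tendsto (fun n : ℕ => (n : ℝ) + (2 - φ)) atTop atTop :=
    tendsto_atTop_add_const_right _ _ tendsto_natCast_atTop_atTop
  have h1 : Tendsto (fun n : ℕ => 1 + (2 * φ - 1) / ((n : ℝ) + (2 - φ))) atTop (𝓝 1) := by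
    simpa using (hden.const_div_atTop (2 * φ - 1)).const_add 1
  have h2 := h1.log one_ne_zero
  rw [Real.log_one] at h2
  refine h2.congr fun n => ?_
  have hn : (0 : ℝ) ≤ n := n.cast_nonneg
  have hd : (n : ℝ) + 2 - φ ≠ 0 := by linarith
  rw [logRatio, ← Real.log_div (by linarith) hd, ← add_sub_assoc]
  rw [one_add_div hd]
  ring_nf

theorem hasSum_logRatio_sub :
    HasSum (fun n : ℕ => (logRatio n - logRatio (n + 1)) / √5) (4 / √5 * Real.log φ) := by
  rw [hasSum_iff_tendsto_nat_of_nonneg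
    (fun n => (hasSum_fib_div_pow n).nonneg fun k => by positivity)]
  simp_rw [← Finset.sum_div, Finset.sum_range_sub', logRatio_zero]
  convert (tendsto_logRatio.const_sub (4 * Real.log φ)).div_const √5 using 2
  ring

theorem hasSum_riemannZeta_re_sub_one_mul_fib :
    HasSum (fun k : ℕ => (Nat.fib (2 * (k + 1)) : ℝ) / (k + 1) *
      ((riemannZeta (2 * (k + 1))).re - 1)) (4 / √5 * Real.log φ) := by
  let f : ℕ × ℕ → ℝ := fun p => (Nat.fib (2 * (p.2 + 1)) : ℝ) / (p.2 + 1) *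
    (1 / ((p.1 : ℝ) + 2) ^ (2 * (p.2 + 1)))
  have hf : Summable f := by
    rw [summable_prod_of_nonneg fun p => by simp only [f, Pi.zero_apply]; positivity]
    refine ⟨fun n => (hasSum_fib_div_pow n).summable, ?_⟩
    simpa only [f, (hasSum_fib_div_pow _).tsum_eq] using hasSum_logRatio_sub.summable
  have hsum : HasSum f (4 / √5 * Real.log φ) := by
    rw [← (hf.hasSum.prod_fiberwise hasSum_fib_div_pow).unique hasSum_logRatio_sub]
    exact hf.hasSum
  exact ((Equiv.prodComm ℕ ℕ).hasSum_iff.2 hsum).prod_fiberwise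
    fun k => (hasSum_one_div_nat_add_two_pow k).mul_left _

theorem stmt15 :
    Summable (fun k : ℕ =>
      (riemannZeta (2 * (k + 1)) - 1) * (Nat.fib (2 * (k + 1)) : ℂ) / (k + 1 : ℂ)) ∧
    ∑' k : ℕ, (riemannZeta (2 * (k + 1)) - 1) * (Nat.fib (2 * (k + 1)) : ℂ) / (k + 1 : ℂ) =
      ((4 / Real.sqrt 5 * Real.log ((1 + Real.sqrt 5) / 2) : ℝ) : ℂ) := by
  have h : HasSum (fun k : ℕ =>
      (riemannZeta (2 * (k + 1)) - 1) * (Nat.fib (2 * (k + 1)) : ℂ) / (k + 1 : ℂ))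
      ((4 / Real.sqrt 5 * Real.log ((1 + Real.sqrt 5) / 2) : ℝ) : ℂ) := by
    refine (Complex.hasSum_ofReal.2 hasSum_riemannZeta_re_sub_one_mul_fib).congr_fun ?_
    intro k
    have hz : riemannZeta (2 * (k + 1)) = ((riemannZeta (2 * (k + 1))).re : ℂ) := by
      rw [riemannZeta_two_mul_add_one_eq_ofReal, Complex.ofReal_re]
    push_cast
    linear_combination (Nat.fib (2 * (k + 1)) / (k + 1) : ℂ) * hz
  exact ⟨h.summable, h.tsum_eq⟩
end
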